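/- (Efficient scaling iteration for Curriculum OT.) Let K be an n×m matrix with strictly positive entries, and let α ∈ ℝ^n, β ∈ ℝ^m have strictly positive entries. Define Dykstra's iteration by Q⁽⁰⁾ = K, U'⁽⁰⁾ = U⁽⁰⁾ = 𝟙_{n×m}, and for t ≥ 1: Q'⁽ᵗ⁾ = diag(min(α/((Q⁽ᵗ⁻¹⁾⊙U'⁽ᵗ⁻¹⁾)𝟙_m), 𝟙_n))·(Q⁽ᵗ⁻¹⁾⊙U'⁽ᵗ⁻¹⁾), U'⁽ᵗ⁾ = U'⁽ᵗ⁻¹⁾⊙(Q⁽ᵗ⁻¹⁾/Q'⁽ᵗ⁾), Q⁽ᵗ⁾ = (Q'⁽ᵗ⁾⊙U⁽ᵗ⁻¹⁾)·diag(β/((Q'⁽ᵗ⁾⊙U⁽ᵗ⁻¹⁾)ᵀ𝟙_n)), U⁽ᵗ⁾ = U⁽ᵗ⁻¹⁾⊙(Q'⁽ᵗ⁾/Q⁽ᵗ⁾). Define also v⁽⁰⁾ = 𝟙_m and, for t ≥ 1, u⁽ᵗ⁾ = min(α/(K v⁽ᵗ⁻¹⁾), 𝟙_n) and v⁽ᵗ⁾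 = β/(Kᵀ u⁽ᵗ⁾). Then for every n ≥ 1: Q⁽ⁿ⁾ = diag(u⁽ⁿ⁾)·K·diag(v⁽ⁿ⁾), U'⁽ⁿ⁾ = diag(1/u⁽ⁿ⁾)·𝟙_{n×m}, and U⁽ⁿ⁾ = 𝟙_{n×m}·diag(1/v⁽ⁿ⁾). -/

import Mathlib

open Finset

/-- One full Dykstra iteration for entropic regularized Curriculum OT, acting on the
state `(Q, U', U)`:
`Q'⁽ᵗ⁾ = diag(min(α/((Q⁽ᵗ⁻¹⁾⊙U'⁽ᵗ⁻¹⁾)𝟙_m), 𝟙_n))·(Q⁽ᵗ⁻¹⁾⊙U'⁽ᵗ⁻¹⁾)`,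
`U'⁽ᵗ⁾ = U'⁽ᵗ⁻¹⁾⊙(Q⁽ᵗ⁻¹⁾/Q'⁽ᵗ⁾)`,
`Q⁽ᵗ⁾ = (Q'⁽ᵗ⁾⊙U⁽ᵗ⁻¹⁾)·diag(β/((Q'⁽ᵗ⁾⊙U⁽ᵗ⁻¹⁾)ᵀ𝟙_n))`,
`U⁽ᵗ⁾ = U⁽ᵗ⁻¹⁾⊙(Q'⁽ᵗ⁾/Q⁽ᵗ⁾)`. -/
noncomputable def dykstraStep {n m : ℕ} (α : Fin n → ℝ) (β : Fin m → ℝ)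
    (s : Matrix (Fin n) (Fin m) ℝ × Matrix (Fin n) (Fin m) ℝ × Matrix (Fin n) (Fin m) ℝ) :
    Matrix (Fin n) (Fin m) ℝ × Matrix (Fin n) (Fin m) ℝ × Matrix (Fin n) (Fin m) ℝ :=
  let Qp := s.1
  let U'p := s.2.1
  let Up := s.2.2
  let A : Matrix (Fin n) (Fin m) ℝ := Matrix.of fun i j => Qp i j * U'p i j
  let Q' : Matrix (Fin n) (Fin m) ℝ :=
    Matrix.of fun i j => min (α i / ∑ j', A i j') 1 * A i j
  let U' : Matrix (Fin n) (Fin m) ℝ := Matrix.of fun i j => U'p i j * (Qp i j / Q' i j)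
  let B : Matrix (Fin n) (Fin m) ℝ := Matrix.of fun i j => Q' i j * Up i j
  let Q : Matrix (Fin n) (Fin m) ℝ := Matrix.of fun i j => B i j * (β j / ∑ i', B i' j)
  let U : Matrix (Fin n) (Fin m) ℝ := Matrix.of fun i j => Up i j * (Q' i j / Q i j)
  (Q, U', U)

/-- Dykstra's algorithm for entropic regularized Curriculum OT, started at
`Q⁽⁰⁾ = K`, `U'⁽⁰⁾ = U⁽⁰⁾ = 𝟙_{n×m}`. -/
noncomputable def dykstraIter {n m : ℕ} (K : Matrix (Fin n) (Fin m) ℝ)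
    (α : Fin n → ℝ) (β : Fin m → ℝ) :
    ℕ → Matrix (Fin n) (Fin m) ℝ × Matrix (Fin n) (Fin m) ℝ × Matrix (Fin n) (Fin m) ℝ
  | 0 => (K, Matrix.of fun _ _ => (1 : ℝ), Matrix.of fun _ _ => (1 : ℝ))
  | t + 1 => dykstraStep α β (dykstraIter K α β t)

/-- The scaling vectors `v⁽ᵗ⁾`: `v⁽⁰⁾ = 𝟙_m`, `v⁽ᵗ⁾ = β/(Kᵀu⁽ᵗ⁾)` where
`u⁽ᵗ⁾ = min(α/(K v⁽ᵗ⁻¹⁾), 𝟙_n)`. -/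
noncomputable def csotV {n m : ℕ} (K : Matrix (Fin n) (Fin m) ℝ)
    (α : Fin n → ℝ) (β : Fin m → ℝ) : ℕ → Fin m → ℝ
  | 0 => fun _ => 1
  | t + 1 => fun j =>
      β j / ∑ i, K i j * min (α i / ∑ j', K i j' * csotV K α β t j') 1

/-- The scaling vectors `u⁽ᵗ⁾ = min(α/(K v⁽ᵗ⁻¹⁾), 𝟙_n)` (for `t ≥ 1`). -/
noncomputable def csotU {n m : ℕ} (K : Matrix (Fin n) (Fin m) ℝ)
    (α : Fin n → ℝ) (β : Fin m → ℝ) (t : ℕ) : Fin n → ℝ :=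
  fun i => min (α i / ∑ j, K i j * csotV K α β (t - 1) j) 1

theorem csotU_succ_pos {n m : ℕ} {K : Matrix (Fin n) (Fin m) ℝ} (hK : ∀ i j, 0 < K i j)
    {α : Fin n → ℝ} (hα : ∀ i, 0 < α i) {β : Fin m → ℝ} {t : ℕ}
    (hv : ∀ j, 0 < csotV K α β t j) (j₀ : Fin m) (i : Fin n) :
    0 < csotU K α β (t + 1) i :=
  lt_min (div_pos (hα i) (sum_pos (fun j _ => mul_pos (hK i j) (hv j)) ⟨j₀, mem_univ _⟩))
    one_pos

theorem csotV_succ {n m : ℕ} (K : Matrix (Fin n) (Fin m) ℝ) (α : Fin n → ℝ) (β : Fin m → ℝ)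
    (t : ℕ) (j : Fin m) :
    csotV K α β (t + 1) j = β j / ∑ i, K i j * csotU K α β (t + 1) i := rfl

theorem csotV_pos {n m : ℕ} {K : Matrix (Fin n) (Fin m) ℝ} (hK : ∀ i j, 0 < K i j)
    {α : Fin n → ℝ} (hα : ∀ i, 0 < α i) {β : Fin m → ℝ} (hβ : ∀ j, 0 < β j)
    (i₀ : Fin n) (t : ℕ) (j : Fin m) : 0 < csotV K α β t j := by
  induction t generalizing j with
  | zero => exact one_pos
  | succ t ih =>
    rw [csotV_succ]
    exact div_pos (hβ j) (sum_pos
      (fun i _ => mul_pos (hK i j) (csotU_succ_pos hK hα ih j i)) ⟨i₀, mem_univ _⟩)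

/-- One Dykstra step maps a state of the form `(diag(u) K diag(v), 1/u, 1/v)`, with `v` the
current scaling vector, to the state given by the next scaling vectors. -/
theorem dykstraStep_scaling {n m : ℕ} {K : Matrix (Fin n) (Fin m) ℝ} (hK : ∀ i j, 0 < K i j)
    {α : Fin n → ℝ} (hα : ∀ i, 0 < α i) {β : Fin m → ℝ} (hβ : ∀ j, 0 < β j)
    (t : ℕ) {u : Fin n → ℝ} (hu : ∀ (_ : Fin m) i, 0 < u i) :
    dykstraStep α β
      (Matrix.of fun i j => u i * K i j * csotV K α β t j,
        Matrix.of fun i _ => 1 / u i, Matrix.of fun _ j => 1 / csotV K α β t j) =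
      (Matrix.of fun i j => csotU K α β (t + 1) i * K i j * csotV K α β (t + 1) j,
        Matrix.of fun i _ => 1 / csotU K α β (t + 1) i,
        Matrix.of fun _ j => 1 / csotV K α β (t + 1) j) := by
  have hA (i : Fin n) (j : Fin m) :
      u i * K i j * csotV K α β t j * (1 / u i) = K i j * csotV K α β t j := by
    have := (hu j i).ne'
    field_simp
  have hU (i : Fin n) : min (α i / ∑ j, K i j * csotV K α β t j) 1 = csotU K α β (t + 1) i := rfl
  have hB (i : Fin n) (j : Fin m) :
      csotU K α β (t + 1) i * (K i j * csotV K α β t j) * (1 / csotV K α β t j) =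
        K i j * csotU K α β (t + 1) i := by
    have := (csotV_pos hK hα hβ i t j).ne'
    field_simp
  simp only [dykstraStep, Matrix.of_apply, hA, hU, hB, ← csotV_succ, Prod.mk.injEq]
  refine ⟨?_, ?_, ?_⟩ <;> ext i j <;> simp only [Matrix.of_apply]
  · ring
  all_goals
    have h₁ := (hu j i).ne'
    have h₂ := (hK i j).ne'
    have h₃ := (csotV_pos hK hα hβ i t j).ne'
    have h₄ := (csotV_pos hK hα hβ i (t + 1) j).ne'
    have h₅ := (csotU_succ_pos hK hα (csotV_pos hK hα hβ i t) j i).ne'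
    field_simp

theorem dykstraIter_succ_eq {n m : ℕ} {K : Matrix (Fin n) (Fin m) ℝ} (hK : ∀ i j, 0 < K i j)
    {α : Fin n → ℝ} (hα : ∀ i, 0 < α i) {β : Fin m → ℝ} (hβ : ∀ j, 0 < β j) (t : ℕ) :
    dykstraIter K α β (t + 1) =
      (Matrix.of fun i j => csotU K α β (t + 1) i * K i j * csotV K α β (t + 1) j,
        Matrix.of fun i _ => 1 / csotU K α β (t + 1) i,
        Matrix.of fun _ j => 1 / csotV K α β (t + 1) j) := by
  induction t with
  | zero =>
    rw [← dykstraStep_scaling hK hα hβ 0 (u := fun _ => 1) fun _ _ => one_pos]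
    simp only [dykstraIter, csotV, one_mul, mul_one, div_one]
    rfl
  | succ t ih =>
    rw [dykstraIter, ih]
    refine dykstraStep_scaling hK hα hβ (t + 1) fun j i => ?_
    exact csotU_succ_pos hK hα (csotV_pos hK hα hβ i t) j i

/-- **Lemma 1: efficient scaling iteration for Curriculum OT.**
For positive `K`, `α`, `β`, the iterates of Dykstra's algorithm are diagonal
scalings of `K`: for every `t ≥ 1`,
`Q⁽ᵗ⁾ = diag(u⁽ᵗ⁾)·K·diag(v⁽ᵗ⁾)`, `U'⁽ᵗ⁾ = diag(1/u⁽ᵗ⁾)·𝟙_{n×m}`, and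
`U⁽ᵗ⁾ = 𝟙_{n×m}·diag(1/v⁽ᵗ⁾)`. -/
theorem dykstra_eq_scaling_iteration
    (n m : ℕ) (K : Matrix (Fin n) (Fin m) ℝ) (hK : ∀ i j, 0 < K i j)
    (α : Fin n → ℝ) (hα : ∀ i, 0 < α i) (β : Fin m → ℝ) (hβ : ∀ j, 0 < β j)
    (t : ℕ) (ht : 1 ≤ t) :
    (dykstraIter K α β t).1
        = Matrix.of (fun i j => csotU K α β t i * K i j * csotV K α β t j) ∧
    (dykstraIter K α β t).2.1 = Matrix.of (fun i j => (1 / csotU K α β t i) * 1) ∧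
    (dykstraIter K α β t).2.2 = Matrix.of (fun i j => 1 * (1 / csotV K α β t j)) := by
  obtain ⟨t, rfl⟩ := Nat.exists_eq_add_of_le' ht
  simp only [dykstraIter_succ_eq hK hα hβ, mul_one, one_mul, and_self]
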